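/- Let Ω be an event of positive probability and let X be a real random variable with E[|X|^{p+2} | Ω] < ∞ for some non-negative integer p. Let κ_l, l = 1, …, p+1, denote the cumulants of X conditioned on Ω. Then for any function Φ : ℝ → ℂ of class C^{p+1} with bounded derivatives Φ^{(l)}, l = 1, …, p+1, one has E[X Φ(X) | Ω] = Σ_{l=0}^{p} (κ_{l+1}/l!) E[Φ^{(l)}(X) | Ω] + ε_p, where the remainder satisfies |ε_p| ≤ C_p · E[ |X|^{p+2} ( 1 + max_{1 ≤ j ≤ p+1} ( ∫_0^1 |Φ^{(p+1)}(vX)| dv )^{(p+2)/j} ) | Ω ] for some constant C_p depending only on p. -/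

import Mathlib

open MeasureTheory ProbabilityTheory
open scoped BigOperators

noncomputable def stB (g : ℝ → ℂ) (x : ℝ) : ℝ := ∫ v in (0:ℝ)..1, ‖g (v * x)‖

lemma stB_nonneg (g : ℝ → ℂ) (x : ℝ) : 0 ≤ stB g x :=
  intervalIntegral.integral_nonneg zero_le_one (fun _ _ => norm_nonneg _)

lemma stB_cont {g : ℝ → ℂ} (hg : Continuous g) : Continuous (stB g) := by
  unfold stB
  apply intervalIntegral.continuous_parametric_intervalIntegral_of_continuous' 
  fun_prop

lemma stB_le {g : ℝ → ℂ} (hg : Continuous g) {K : ℝ} (hK : ∀ x, ‖g x‖ ≤ K) (x : ℝ) :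
    stB g x ≤ K := by
  have : stB g x ≤ ∫ v in (0:ℝ)..1, K := by
    apply intervalIntegral.integral_mono_on zero_le_one
    · apply Continuous.intervalIntegrable; fun_prop
    · simp
    · intro v _; exact hK _
  simpa using this

lemma stB_scale {g : ℝ → ℂ} (hg : Continuous g) (x : ℝ) {v : ℝ} (h0 : 0 ≤ v) (h1 : v ≤ 1) :
    v * stB g (v * x) ≤ stB g x := by
  rcases h0.eq_or_lt with h | h
  · subst h; simpa using stB_nonneg g x
  · unfold stB
    have := intervalIntegral.integral_comp_mul_left (a := 0) (b := 1)
      (fun s => ‖g (s * x)‖) h.ne'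
    have e : ∀ s : ℝ, s * (v * x) = v * s * x := fun s => by ring
    simp only [e, this]
    simp only [mul_zero, mul_one, smul_eq_mul]
    rw [mul_inv_cancel_left₀ h.ne']
    apply intervalIntegral.integral_mono_interval le_rfl h.le h1
    · exact Filter.Eventually.of_forall fun _ => norm_nonneg _
    · apply Continuous.intervalIntegrable; fun_prop

lemma st_taylor (n : ℕ) : ∀ (f : ℝ → ℂ), ContDiff ℝ (n + 1 : ℕ) f → ∀ x : ℝ,
    ‖f x - ∑ k ∈ Finset.range (n + 1), ((x ^ k / (k.factorial) : ℝ) : ℂ) * iteratedDeriv k f 0‖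
      ≤ |x| ^ (n + 1) * stB (iteratedDeriv (n + 1) f) x := by
  induction n with
  | zero =>
    intro f hf x
    have hd : Continuous (deriv f) := hf.continuous_deriv (by norm_num)
    have hdiff : Differentiable ℝ f := hf.differentiable (by norm_num)
    simp only [zero_add, Finset.range_one, Finset.sum_singleton, pow_zero, Nat.factorial_zero,
      iteratedDeriv_zero, iteratedDeriv_one, pow_one]
    have key : ∫ v in (0:ℝ)..1, (x : ℂ) * deriv f (v * x) = f (1 * x) - f (0 * x) := by
      apply intervalIntegral.integral_eq_sub_of_hasDerivAt (f := fun v => f (v * x))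
      · intro v _
        have h1 : HasDerivAt (fun v : ℝ => v * x) x v := by
          simpa using (hasDerivAt_id v).mul_const x
        have := HasDerivAt.scomp v (hdiff (v * x)).hasDerivAt h1
        simpa [Function.comp_def] using this
      · apply Continuous.intervalIntegrable; fun_prop
    have : f x - ((1 / (1:ℕ) : ℝ) : ℂ) * f 0 = ∫ v in (0:ℝ)..1, (x : ℂ) * deriv f (v * x) := by
      rw [key]; simp
    rw [this, intervalIntegral.integral_const_mul, norm_mul]
    simp only [Complex.norm_real, Real.norm_eq_abs]
    gcongr
    exact intervalIntegral.norm_integral_le_integral_norm zero_le_one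
  | succ n ih =>
    intro f hf x
    have hd : ContDiff ℝ (n + 1 : ℕ) (deriv f) := by
      have : ContDiff ℝ ((n + 1 : ℕ) + 1) f := by exact_mod_cast hf
      exact (contDiff_succ_iff_deriv.1 this).2.2
    have hdiff : Differentiable ℝ f := hf.differentiable (by simp)
    have hg : Continuous (iteratedDeriv (n + 1) (deriv f)) :=
      hd.continuous_iteratedDeriv' _
    have ih' := ih _ hd
    rw [Finset.sum_range_succ']
    simp only [iteratedDeriv_succ' (f := f), iteratedDeriv_zero] 
    set h : ℝ → ℂ := fun v => f (v * x) -
      ∑ k ∈ Finset.range (n + 1), (((v * x) ^ (k + 1) / ((k + 1).factorial) : ℝ) : ℂ) *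
        iteratedDeriv k (deriv f) 0 with hh
    have hder : ∀ v : ℝ, HasDerivAt h ((x : ℂ) * (deriv f (v * x) -
        ∑ k ∈ Finset.range (n + 1), (((v * x) ^ k / (k.factorial) : ℝ) : ℂ) *
        iteratedDeriv k (deriv f) 0)) v := by
      intro v
      have h1 : HasDerivAt (fun v : ℝ => v * x) x v := by
        simpa using (hasDerivAt_id v).mul_const x
      have h2 : HasDerivAt (fun v => f (v * x)) ((x : ℂ) * deriv f (v * x)) v := by
        have := HasDerivAt.scomp v (hdiff (v * x)).hasDerivAt h1
        simpa [Function.comp_def] using this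
      rw [mul_sub, Finset.mul_sum]
      refine h2.sub (HasDerivAt.fun_sum fun k _ => ?_)
      rw [← mul_assoc]
      refine HasDerivAt.mul_const ?_ _
      have h3 : HasDerivAt (fun v : ℝ => (v * x) ^ (k + 1) / ((k + 1).factorial : ℝ))
          (x * ((v * x) ^ k / (k.factorial))) v := by
        refine ((h1.pow (k + 1)).div_const _).congr_deriv ?_
        rw [Nat.factorial_succ]
        have : (k.factorial : ℝ) ≠ 0 := by positivity
        push_cast
        field_simp
      simpa using h3.ofReal_comp
    have mv := norm_image_sub_le_of_norm_deriv_le_segment_01' (f := h)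
      (C := |x| ^ (n + 1 + 1) * stB (iteratedDeriv (n + 1) (deriv f)) x)
      (fun v _ => (hder v).hasDerivWithinAt) (by
        intro v hv
        rw [norm_mul]
        simp only [Complex.norm_real, Real.norm_eq_abs]
        calc _ ≤ |x| * (|v * x| ^ (n + 1) * stB (iteratedDeriv (n + 1) (deriv f)) (v * x)) := by
              gcongr; exact ih' _
          _ = |x| ^ (n + 1 + 1) * (v ^ n * (v * stB (iteratedDeriv (n + 1) (deriv f)) (v * x))) := by
              rw [abs_mul, abs_of_nonneg hv.1]; ring
          _ ≤ |x| ^ (n + 1 + 1) * (1 * stB (iteratedDeriv (n + 1) (deriv f)) x) := by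
              have := stB_nonneg (iteratedDeriv (n + 1) (deriv f)) (v * x)
              have := hv.1
              gcongr
              · exact pow_le_one₀ hv.1 hv.2.le
              · exact stB_scale hg x hv.1 hv.2.le
          _ = _ := by ring)
    have e : h 1 - h 0 = f x - (∑ k ∈ Finset.range (n + 1), ((x ^ (k + 1) / ((k + 1).factorial) : ℝ) : ℂ) *
        iteratedDeriv k (deriv f) 0 + ((x ^ 0 / (Nat.factorial 0) : ℝ) : ℂ) * f 0) := by
      simp [hh]; ring
    rw [← e]
    exact mv

lemma st_young {s t : ℝ} (hs : 0 ≤ s) (ht : 0 ≤ t) (a b : ℕ) :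
    s ^ a * t ^ b ≤ s ^ (a + b) + t ^ (a + b) := by
  rcases le_total s t with h | h
  · calc s ^ a * t ^ b ≤ t ^ a * t ^ b := by gcongr
      _ = t ^ (a + b) := by ring
      _ ≤ _ := by linarith [pow_nonneg hs (a + b)]
  · calc s ^ a * t ^ b ≤ s ^ a * s ^ b := by gcongr
      _ = s ^ (a + b) := by ring
      _ ≤ _ := by linarith [pow_nonneg ht (a + b)]

/-- decoupling: if `f x * g y ≤ F x + G y` then the same holds for expectations -/
lemma st_decouple {Ω : Type} [MeasurableSpace Ω] (μ : Measure Ω) [IsProbabilityMeasure μ]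
    {f g F G : Ω → ℝ} (hf : Integrable f μ) (hg : Integrable g μ) (hF : Integrable F μ)
    (hG : Integrable G μ) (h : ∀ x y, f x * g y ≤ F x + G y) :
    (∫ x, f x ∂μ) * (∫ y, g y ∂μ) ≤ (∫ x, F x ∂μ) + ∫ y, G y ∂μ := by
  have h1 : ∀ x, f x * (∫ y, g y ∂μ) ≤ F x + ∫ y, G y ∂μ := by
    intro x
    have := integral_mono (hg.const_mul (f x)) ((integrable_const (F x)).add hG) (h x)
    simp only [Pi.add_apply] at this
    rw [integral_const_mul, integral_add (integrable_const _) hG] at this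
    simpa using this
  have := integral_mono (hf.mul_const _) (hF.add (integrable_const (∫ y, G y ∂μ))) h1
  simp only [Pi.add_apply] at this
  rw [integral_mul_const, integral_add hF (integrable_const _)] at this
  simpa using this

lemma st_pow_int {Ω : Type} [MeasurableSpace Ω] (μ : Measure Ω) [IsProbabilityMeasure μ]
    {X : Ω → ℝ} (hX : Measurable X) {q : ℕ} (h : Integrable (fun ω => |X ω| ^ q) μ)
    {k : ℕ} (hk : k ≤ q) : Integrable (fun ω => |X ω| ^ k) μ := by
  refine ((integrable_const (1:ℝ)).add h).mono' (by fun_prop) (Filter.Eventually.of_forall ?_)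
  intro ω
  have := st_young (s := 1) (t := |X ω|) zero_le_one (abs_nonneg _) (q - k) k
  simp only [one_pow, one_mul, Nat.sub_add_cancel hk] at this
  simpa [abs_of_nonneg] using this

lemma st_cum (N : ℕ) : ∃ c : ℝ, 0 ≤ c ∧
    ∀ (Ω : Type) (_ : MeasurableSpace Ω) (μ : Measure Ω), IsProbabilityMeasure μ →
    ∀ (X : Ω → ℝ), Measurable X → Integrable (fun ω => |X ω| ^ N) μ →
    ∀ (κ : ℕ → ℝ),
        (∀ n : ℕ, 1 ≤ n → n ≤ N →
          ∫ ω, X ω ^ n ∂μ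
            = ∑ l ∈ Finset.range n,
                ((n - 1).choose l : ℝ) * κ (l + 1) * ∫ ω, X ω ^ (n - 1 - l) ∂μ) →
    ∀ l < N, |κ (l + 1)| ≤ c * ∫ ω, |X ω| ^ (l + 1) ∂μ := by
  induction N with
  | zero => exact ⟨0, le_rfl, fun _ _ _ _ _ _ _ _ _ l hl => absurd hl (by simp)⟩
  | succ N ih =>
    obtain ⟨c, hc, ih⟩ := ih
    refine ⟨max c (1 + ∑ i ∈ Finset.range N, (N.choose i : ℝ) * c * 2), by positivity, ?_⟩
    intro Ω _ μ _ X hX hint κ hκ l hl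
    have hpi := fun k (hk : k ≤ N + 1) => st_pow_int μ hX hint hk
    have hold := ih Ω _ μ inferInstance X hX (hpi N (by omega)) κ
      (fun n h1 h2 => hκ n h1 (by omega))
    have hnn : ∀ k, 0 ≤ ∫ ω, |X ω| ^ k ∂μ := fun k => integral_nonneg fun _ => by positivity
    have hmom : ∀ k, |∫ ω, X ω ^ k ∂μ| ≤ ∫ ω, |X ω| ^ k ∂μ := by
      intro k
      refine (abs_integral_le_integral_abs).trans (le_of_eq ?_)
      simp only [abs_pow]
    rcases Nat.lt_succ_iff_lt_or_eq.1 hl with h | h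
    · exact (hold l h).trans (mul_le_mul_of_nonneg_right (le_max_left _ _) (hnn _))
    · subst h
      have r := hκ (l + 1) (by omega) le_rfl
      rw [Finset.sum_range_succ] at r
      simp only [Nat.add_sub_cancel, Nat.choose_self, Nat.sub_self, pow_zero, integral_const,
        probReal_univ, smul_eq_mul, mul_one, Nat.cast_one, one_mul] at r
      have e : κ (l + 1) = ∫ ω, X ω ^ (l + 1) ∂μ - ∑ i ∈ Finset.range l,
          (l.choose i : ℝ) * κ (i + 1) * ∫ ω, X ω ^ (l - i) ∂μ := by linarith
      have hb : |κ (l + 1)| ≤ (1 + ∑ i ∈ Finset.range l, (l.choose i : ℝ) * c * 2) *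
          ∫ ω, |X ω| ^ (l + 1) ∂μ := by
        rw [e, add_mul, one_mul, Finset.sum_mul]
        refine (abs_sub _ _).trans (add_le_add (hmom _) ?_)
        refine (Finset.abs_sum_le_sum_abs _ _).trans (Finset.sum_le_sum fun i hi => ?_)
        have hi' : i < l := Finset.mem_range.1 hi
        rw [abs_mul, abs_mul, Nat.abs_cast]
        have d := st_decouple μ (hpi (i + 1) (by omega)) (hpi (l - i) (by omega))
          (hpi (l + 1) le_rfl) (hpi (l + 1) le_rfl) (fun x y => by
            have := st_young (abs_nonneg (X x)) (abs_nonneg (X y)) (i + 1) (l - i)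
            rwa [show i + 1 + (l - i) = l + 1 by omega] at this)
        calc _ ≤ (l.choose i : ℝ) * (c * ∫ ω, |X ω| ^ (i + 1) ∂μ) * ∫ ω, |X ω| ^ (l - i) ∂μ := by
              have := hnn (i + 1)
              gcongr
              · exact hold i hi'
              · exact hmom _
          _ = (l.choose i : ℝ) * c * ((∫ ω, |X ω| ^ (i + 1) ∂μ) * ∫ ω, |X ω| ^ (l - i) ∂μ) := by ring
          _ ≤ (l.choose i : ℝ) * c * (∫ ω, |X ω| ^ (l + 1) ∂μ + ∫ ω, |X ω| ^ (l + 1) ∂μ) := by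
              gcongr
          _ = _ := by ring
      exact hb.trans (mul_le_mul_of_nonneg_right (le_max_right _ _) (hnn _))

lemma st_comb (p : ℕ) (m κ : ℕ → ℝ) (c : ℕ → ℂ)
    (h : ∀ n : ℕ, 1 ≤ n → n ≤ p + 1 →
      m n = ∑ l ∈ Finset.range n, ((n - 1).choose l : ℝ) * κ (l + 1) * m (n - 1 - l)) :
    ∑ k ∈ Finset.range (p + 1), ((m (k + 1) / (k.factorial) : ℝ) : ℂ) * c k =
    ∑ l ∈ Finset.range (p + 1), ((κ (l + 1) / (l.factorial) : ℝ) : ℂ) *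
      ∑ k ∈ Finset.range (p - l + 1), ((m k / (k.factorial) : ℝ) : ℂ) * c (k + l) := by
  have e : ∀ k ∈ Finset.range (p + 1), ((m (k + 1) / (k.factorial) : ℝ) : ℂ) * c k =
      ∑ l ∈ Finset.range (k + 1), ((κ (l + 1) / (l.factorial) : ℝ) : ℂ) *
        (((m (k - l) / ((k - l).factorial) : ℝ) : ℂ) * c k) := by
    intro k hk
    have hk' := Finset.mem_range.1 hk
    rw [h (k + 1) (by omega) (by omega), Finset.sum_div, Complex.ofReal_sum, Finset.sum_mul]
    refine Finset.sum_congr rfl fun l hl => ?_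
    have hl' : l ≤ k := by have := Finset.mem_range.1 hl; omega
    rw [← mul_assoc, ← Complex.ofReal_mul]
    congr 2
    simp only [Nat.add_sub_cancel]
    rw [Nat.cast_choose ℝ hl']
    have h1 : (k.factorial : ℝ) ≠ 0 := by positivity
    have h2 : (l.factorial : ℝ) ≠ 0 := by positivity
    have h3 : ((k - l).factorial : ℝ) ≠ 0 := by positivity
    field_simp
  rw [Finset.sum_congr rfl e]
  simp only [Finset.mul_sum]
  rw [Finset.sum_sigma', Finset.sum_sigma']
  refine Finset.sum_bij' (fun a _ => (⟨a.2, a.1 - a.2⟩ : Σ _ : ℕ, ℕ))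
    (fun a _ => (⟨a.2 + a.1, a.1⟩ : Σ _ : ℕ, ℕ)) ?_ ?_ ?_ ?_ ?_
  · rintro ⟨a, b⟩ hab; simp only [Finset.mem_sigma, Finset.mem_range] at hab ⊢; omega
  · rintro ⟨a, b⟩ hab; simp only [Finset.mem_sigma, Finset.mem_range] at hab ⊢; omega
  · rintro ⟨a, b⟩ hab
    simp only [Finset.mem_sigma, Finset.mem_range] at hab
    simp only [Sigma.mk.injEq, heq_eq_eq, and_true]; omega
  · rintro ⟨a, b⟩ hab
    simp
  · rintro ⟨a, b⟩ hab
    simp only [Finset.mem_sigma, Finset.mem_range] at hab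
    simp only [Nat.sub_add_cancel (show b ≤ a by omega)]

lemma st_iter (k l : ℕ) (f : ℝ → ℂ) :
    iteratedDeriv k (iteratedDeriv l f) = iteratedDeriv (k + l) f := by
  simp only [iteratedDeriv_eq_iterate, Function.iterate_add_apply]

lemma st_core (p : ℕ) :
    ∃ C : ℝ, 0 < C ∧
      ∀ (Ωs : Type) (_ : MeasurableSpace Ωs) (μ : Measure Ωs), IsProbabilityMeasure μ →
      ∀ (X : Ωs → ℝ), Measurable X →
        Integrable (fun ω => |X ω| ^ (p + 2)) μ →
      ∀ (κ : ℕ → ℝ),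
        (∀ n : ℕ, 1 ≤ n → n ≤ p + 1 →
          ∫ ω, X ω ^ n ∂μ
            = ∑ l ∈ Finset.range n,
                ((n - 1).choose l : ℝ) * κ (l + 1) * ∫ ω, X ω ^ (n - 1 - l) ∂μ) →
      ∀ (Φ : ℝ → ℂ), ContDiff ℝ (p + 1 : ℕ) Φ →
        (∀ l : ℕ, 1 ≤ l → l ≤ p + 1 → ∃ K : ℝ, ∀ x : ℝ, ‖iteratedDeriv l Φ x‖ ≤ K) →
        ‖(∫ ω, (X ω : ℂ) * Φ (X ω) ∂μ)
            - ∑ l ∈ Finset.range (p + 1),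
                ((κ (l + 1) / (Nat.factorial l) : ℝ) : ℂ) *
                  ∫ ω, iteratedDeriv l Φ (X ω) ∂μ‖
          ≤ C * ∫ ω, |X ω| ^ (p + 2) *
              (1 + (Finset.Icc 1 (p + 1)).sup' (Finset.nonempty_Icc.2 (Nat.le_add_left 1 p))
                (fun j => (stB (iteratedDeriv (p + 1) Φ) (X ω))
                  ^ ((p + 2 : ℝ) / j))) ∂μ := by
  obtain ⟨c, hc, hcum⟩ := st_cum (p + 1)
  refine ⟨1 + ∑ l ∈ Finset.range (p + 1), c * 2, by positivity, ?_⟩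
  intro Ω _ μ _ X hX hint κ hκ Φ hΦ hbd
  have hpi := fun k (hk : k ≤ p + 2) => st_pow_int μ hX hint hk
  have hcb := hcum Ω _ μ inferInstance X hX (hpi (p + 1) (by omega)) κ hκ
  obtain ⟨K, hK⟩ := hbd (p + 1) (by omega) le_rfl
  have hgc : Continuous (iteratedDeriv (p + 1) Φ) := hΦ.continuous_iteratedDeriv' _
  set A : ℝ → ℝ := stB (iteratedDeriv (p + 1) Φ) with hA
  have hAc : Continuous A := stB_cont hgc
  have hA0 : ∀ x, 0 ≤ A x := stB_nonneg _
  have hAK : ∀ x, A x ≤ K := stB_le hgc hK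
  have hK0 : 0 ≤ K := (hA0 0).trans (hAK 0)
  have hne : (Finset.Icc 1 (p + 1)).Nonempty := Finset.nonempty_Icc.2 (Nat.le_add_left 1 p)
  set S : ℝ → ℝ := fun a => (Finset.Icc 1 (p + 1)).sup' hne
    (fun j : ℕ => a ^ ((p + 2 : ℝ) / j)) with hS
  have hSc : Continuous S := by
    apply Continuous.finset_sup'_apply
    intro j _
    exact Real.continuous_rpow_const (by positivity)
  have hSle : ∀ a, ∀ j : ℕ, 1 ≤ j → j ≤ p + 1 → a ^ ((p + 2 : ℝ) / j) ≤ S a := by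
    intro a j h1 h2
    exact Finset.le_sup' (fun j : ℕ => a ^ ((p + 2 : ℝ) / j)) (Finset.mem_Icc.2 ⟨h1, h2⟩)
  have hSmono : ∀ a b, 0 ≤ a → a ≤ b → S a ≤ S b := by
    intro a b h0 hab
    apply Finset.sup'_mono_fun
    intro j _
    exact Real.rpow_le_rpow h0 hab (by positivity)
  have hS0 : ∀ a, 0 ≤ a → 0 ≤ S a := fun a ha =>
    (Real.rpow_nonneg ha _).trans (hSle a 1 le_rfl (by omega))
  set G : ℝ → ℝ := fun x => |x| ^ (p + 2) * (1 + S (A x)) with hG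
  have hGc : Continuous G := by fun_prop
  have hGi : Integrable (fun ω => G (X ω)) μ := by
    refine (hint.mul_const (1 + S K)).mono' (hGc.measurable.comp hX).aestronglyMeasurable
      (Filter.Eventually.of_forall fun ω => ?_)
    have := hS0 _ (hA0 (X ω))
    rw [Real.norm_of_nonneg (by positivity)]
    have := hSmono _ _ (hA0 (X ω)) (hAK (X ω))
    simp only [hG]
    gcongr
  change _ ≤ _ * ∫ ω, G (X ω) ∂μ
  set W := ∫ ω, G (X ω) ∂μ with hW
  -- the remainders
  set R : ℕ → ℝ → ℂ := fun l x => iteratedDeriv l Φ x -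
    ∑ k ∈ Finset.range (p - l + 1), ((x ^ k / (k.factorial) : ℝ) : ℂ) * iteratedDeriv (k + l) Φ 0
    with hR
  have hRb : ∀ l ≤ p, ∀ x, ‖R l x‖ ≤ |x| ^ (p + 1 - l) * A x := by
    intro l hl x
    have hcd : ContDiff ℝ (p - l + 1 : ℕ) (iteratedDeriv l Φ) := by
      rw [iteratedDeriv_eq_iterate]
      apply ContDiff.iterate_deriv'
      rwa [show p - l + 1 + l = p + 1 by omega]
    have := st_taylor (p - l) _ hcd x
    simp only [st_iter] at this
    rw [show p - l + 1 + l = p + 1 by omega] at this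
    rw [show p + 1 - l = p - l + 1 by omega]
    exact this
  have hRc : ∀ l ≤ p, Continuous (R l) := by
    intro l hl
    have : Continuous (iteratedDeriv l Φ) :=
      hΦ.continuous_iteratedDeriv l (by exact_mod_cast (by omega : l ≤ p + 1))
    fun_prop
  have hPi : ∀ j ≤ p + 2, Integrable (fun ω => |X ω| ^ j * A (X ω)) μ := by
    intro j hj
    refine ((hpi j hj).mul_const K).mono'
      ((show Continuous fun x : ℝ => |x| ^ j * A x by fun_prop).measurable.comp hX).aestronglyMeasurable
      (Filter.Eventually.of_forall fun ω => ?_)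
    have := hA0 (X ω)
    have := hAK (X ω)
    rw [Real.norm_of_nonneg (by positivity)]
    gcongr
  have hRi : ∀ l ≤ p, Integrable (fun ω => R l (X ω)) μ := by
    intro l hl
    exact (hPi (p + 1 - l) (by omega)).mono'
      ((hRc l hl).measurable.comp hX).aestronglyMeasurable
      (Filter.Eventually.of_forall fun ω => hRb l hl _)
  have hXRb : ∀ x : ℝ, ‖(x : ℂ) * R 0 x‖ ≤ |x| ^ (p + 2) * A x := by
    intro x
    rw [norm_mul, Complex.norm_real, Real.norm_eq_abs]
    calc _ ≤ |x| * (|x| ^ (p + 1 - 0) * A x) := by gcongr; exact hRb 0 (by omega) x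
      _ = _ := by rw [Nat.sub_zero]; ring
  have hXRi : Integrable (fun ω => (X ω : ℂ) * R 0 (X ω)) μ := by
    have hc0 := hRc 0 (by omega)
    exact (hPi (p + 2) le_rfl).mono'
      ((show Continuous fun x : ℝ => (x : ℂ) * R 0 x by fun_prop).measurable.comp hX).aestronglyMeasurable
      (Filter.Eventually.of_forall fun ω => hXRb _)
  -- moments
  have hXi : ∀ k ≤ p + 2, Integrable (fun ω => X ω ^ k) μ := by
    intro k hk
    refine (hpi k hk).mono' (by fun_prop) (Filter.Eventually.of_forall fun ω => ?_)
    simp [abs_pow]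
  have hmi : ∀ k ≤ p + 2, ∀ (d : ℝ) (z : ℂ),
      Integrable (fun ω => ((X ω ^ k / d : ℝ) : ℂ) * z) μ := by
    intro k hk d z
    exact (((hXi k hk).div_const d).ofReal).mul_const z
  have hmv : ∀ k, ∀ (d : ℝ) (z : ℂ),
      ∫ ω, ((X ω ^ k / d : ℝ) : ℂ) * z ∂μ = (((∫ ω, X ω ^ k ∂μ) / d : ℝ) : ℂ) * z := by
    intro k d z
    rw [integral_mul_const, integral_complex_ofReal, integral_div]
  have hE : ∀ l ∈ Finset.range (p + 1), ∫ ω, iteratedDeriv l Φ (X ω) ∂μ = ∫ ω, R l (X ω) ∂μ +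
      ∑ k ∈ Finset.range (p - l + 1), (((∫ ω, X ω ^ k ∂μ) / (k.factorial) : ℝ) : ℂ) *
        iteratedDeriv (k + l) Φ 0 := by
    intro l hl
    have hl' := Finset.mem_range.1 hl
    have hki : ∀ k ∈ Finset.range (p - l + 1), Integrable (fun ω =>
      ((X ω ^ k / (k.factorial) : ℝ) : ℂ) * iteratedDeriv (k + l) Φ 0) μ := fun k hk => by
        have := Finset.mem_range.1 hk
        exact hmi k (by omega) _ _
    rw [← Finset.sum_congr rfl (fun k _ => hmv k (k.factorial) (iteratedDeriv (k + l) Φ 0)),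
      ← integral_finsetSum _ hki, ← integral_add (hRi l (by omega)) (integrable_finsetSum _ hki)]
    simp [hR]
  have hE0 : ∫ ω, (X ω : ℂ) * Φ (X ω) ∂μ = ∫ ω, (X ω : ℂ) * R 0 (X ω) ∂μ +
      ∑ k ∈ Finset.range (p + 1), (((∫ ω, X ω ^ (k + 1) ∂μ) / (k.factorial) : ℝ) : ℂ) *
        iteratedDeriv k Φ 0 := by
    have hki : ∀ k ∈ Finset.range (p + 1), Integrable (fun ω =>
      ((X ω ^ (k + 1) / (k.factorial) : ℝ) : ℂ) * iteratedDeriv k Φ 0) μ := fun k hk => by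
        have := Finset.mem_range.1 hk
        exact hmi (k + 1) (by omega) _ _
    rw [← Finset.sum_congr rfl (fun k _ => hmv (k + 1) (k.factorial) (iteratedDeriv k Φ 0)),
      ← integral_finsetSum _ hki, ← integral_add hXRi (integrable_finsetSum _ hki)]
    congr 1
    ext ω
    simp only [hR, iteratedDeriv_zero, Nat.sub_zero, add_zero, mul_sub, Finset.mul_sum]
    rw [sub_add, ← Finset.sum_sub_distrib, Finset.sum_eq_zero, sub_zero]
    intro k _
    push_cast
    ring
  have hcomb := st_comb p (fun n => ∫ ω, X ω ^ n ∂μ) κ (fun k => iteratedDeriv k Φ 0) hκ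
  have hid : (∫ ω, (X ω : ℂ) * Φ (X ω) ∂μ)
            - ∑ l ∈ Finset.range (p + 1),
                ((κ (l + 1) / (Nat.factorial l) : ℝ) : ℂ) *
                  ∫ ω, iteratedDeriv l Φ (X ω) ∂μ =
      ∫ ω, (X ω : ℂ) * R 0 (X ω) ∂μ - ∑ l ∈ Finset.range (p + 1),
                ((κ (l + 1) / (Nat.factorial l) : ℝ) : ℂ) * ∫ ω, R l (X ω) ∂μ := by
    have hs : ∑ l ∈ Finset.range (p + 1), ((κ (l + 1) / (Nat.factorial l) : ℝ) : ℂ) *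
          ∫ ω, iteratedDeriv l Φ (X ω) ∂μ = ∑ l ∈ Finset.range (p + 1),
          ((κ (l + 1) / (Nat.factorial l) : ℝ) : ℂ) * (∫ ω, R l (X ω) ∂μ +
      ∑ k ∈ Finset.range (p - l + 1), (((∫ ω, X ω ^ k ∂μ) / (k.factorial) : ℝ) : ℂ) *
        iteratedDeriv (k + l) Φ 0) :=
      Finset.sum_congr rfl (fun l hl => by rw [hE l hl])
    rw [hE0, hcomb, hs]
    simp only [mul_add, Finset.sum_add_distrib]
    ring
  rw [hid, add_mul, one_mul, Finset.sum_mul]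
  refine (norm_sub_le _ _).trans (add_le_add ?_ ((norm_sum_le _ _).trans
    (Finset.sum_le_sum fun l hl => ?_)))
  · refine norm_integral_le_of_norm_le hGi (Filter.Eventually.of_forall fun ω => ?_)
    refine (hXRb _).trans ?_
    simp only [hG]
    gcongr
    have h1 := hSle (A (X ω)) 1 le_rfl (by omega)
    have h2 := hS0 _ (hA0 (X ω))
    rcases le_total (A (X ω)) 1 with h | h
    · linarith
    · have := Real.self_le_rpow_of_one_le h (show (1:ℝ) ≤ (p + 2 : ℝ) / (1 : ℕ) by
        have : (0:ℝ) ≤ p := by positivity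
        simp; linarith)
      linarith
  · have hl' : l ≤ p := by have := Finset.mem_range.1 hl; omega
    have hnn : 0 ≤ ∫ ω, |X ω| ^ (l + 1) ∂μ := integral_nonneg fun _ => by positivity
    have h1 : ‖∫ ω, R l (X ω) ∂μ‖ ≤ ∫ ω, |X ω| ^ (p + 1 - l) * A (X ω) ∂μ :=
      norm_integral_le_of_norm_le (hPi _ (by omega))
        (Filter.Eventually.of_forall fun ω => hRb l hl' _)
    have h2 : ‖((κ (l + 1) / (Nat.factorial l) : ℝ) : ℂ)‖ ≤ c * ∫ ω, |X ω| ^ (l + 1) ∂μ := by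
      rw [Complex.norm_real, Real.norm_eq_abs, abs_div, Nat.abs_cast]
      refine (div_le_self (abs_nonneg _) ?_).trans (hcb l (by omega))
      exact_mod_cast Nat.one_le_iff_ne_zero.2 (Nat.factorial_ne_zero l)
    have h3 := st_decouple μ (hpi (l + 1) (by omega)) (hPi (p + 1 - l) (by omega)) hGi hGi (by
      intro x y
      obtain ⟨j, hj⟩ : ∃ j, j = p + 1 - l := ⟨_, rfl⟩
      have hj1 : 1 ≤ j := by omega
      rw [← hj]
      have hj0 : (j : ℝ) ≠ 0 := by positivity
      set a := A (X y) with ha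
      have ha0 : 0 ≤ a := hA0 _
      have yg := st_young (abs_nonneg (X x)) (t := |X y| * a ^ ((1:ℝ) / j))
        (by positivity) (l + 1) j
      rw [show l + 1 + j = p + 2 by omega, mul_pow, mul_pow, ← Real.rpow_natCast (a ^ _) j,
        ← Real.rpow_natCast (a ^ _) (p + 2), ← Real.rpow_mul ha0, ← Real.rpow_mul ha0,
        one_div_mul_cancel hj0, Real.rpow_one] at yg
      refine yg.trans (add_le_add ?_ ?_)
      · have := hS0 _ (hA0 (X x))
        exact le_mul_of_one_le_right (by positivity) (by linarith)
      · have := hSle a j hj1 (by omega)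
        simp only [hG]
        gcongr
        rw [show (1:ℝ) / j * ((p + 2 : ℕ) : ℝ) = (p + 2 : ℝ) / j by push_cast; ring]
        linarith)
    rw [norm_mul]
    calc _ ≤ (c * ∫ ω, |X ω| ^ (l + 1) ∂μ) * ∫ ω, |X ω| ^ (p + 1 - l) * A (X ω) ∂μ := by gcongr
      _ = c * ((∫ ω, |X ω| ^ (l + 1) ∂μ) * ∫ ω, |X ω| ^ (p + 1 - l) * A (X ω) ∂μ) := by ring
      _ ≤ c * (W + W) := by gcongr
      _ = _ := by ring




theorem stein_lemma_with_remainder (p : ℕ) :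
    ∃ C : ℝ, 0 < C ∧
      ∀ (Ωs : Type) (_ : MeasurableSpace Ωs) (P : Measure Ωs), IsProbabilityMeasure P →
      ∀ (E : Set Ωs), 0 < P E →
      ∀ (X : Ωs → ℝ), Measurable X →
        Integrable (fun ω => |X ω| ^ (p + 2)) (P[|E]) →
      ∀ (κ : ℕ → ℝ),
        -- the conditional cumulants of `X` given `E`, via the moment–cumulant recursion
        (∀ n : ℕ, 1 ≤ n → n ≤ p + 1 →
          ∫ ω, X ω ^ n ∂(P[|E])
            = ∑ l ∈ Finset.range n,
                ((n - 1).choose l : ℝ) * κ (l + 1) * ∫ ω, X ω ^ (n - 1 - l) ∂(P[|E])) →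
      ∀ (Φ : ℝ → ℂ), ContDiff ℝ (p + 1 : ℕ) Φ →
        (∀ l : ℕ, 1 ≤ l → l ≤ p + 1 → ∃ K : ℝ, ∀ x : ℝ, ‖iteratedDeriv l Φ x‖ ≤ K) →
        ‖(∫ ω, (X ω : ℂ) * Φ (X ω) ∂(P[|E]))
            - ∑ l ∈ Finset.range (p + 1),
                ((κ (l + 1) / (Nat.factorial l) : ℝ) : ℂ) *
                  ∫ ω, iteratedDeriv l Φ (X ω) ∂(P[|E])‖
          ≤ C * ∫ ω, |X ω| ^ (p + 2) *
              (1 + (Finset.Icc 1 (p + 1)).sup' (Finset.nonempty_Icc.2 (Nat.le_add_left 1 p))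
                (fun j => (∫ v in (0:ℝ)..1, ‖iteratedDeriv (p + 1) Φ (v * X ω)‖)
                  ^ ((p + 2 : ℝ) / j))) ∂(P[|E]) := by
  obtain ⟨C, hC, h⟩ := st_core p
  refine ⟨C, hC, ?_⟩
  intro Ωs _ P _ E hE X hX hint κ hκ Φ hΦ hb
  have : IsProbabilityMeasure (P[|E]) := cond_isProbabilityMeasure hE.ne'
  exact h Ωs _ (P[|E]) this X hX hint κ hκ Φ hΦ hb
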